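/- Let N and s be positive integers and c=(c_1,…,c_{2s}) a tuple of positive integers. Then h_N(c) = Σ over even-odd subsets A ⊂ [2s]^1_c, and over subsets B ⊂ [2s]^{>1}_c containing no pair {2r,2r+1} (r ∈ {1,…,s−1}), of (−1)^{#B}·N^{−(#A+#B)}·g_N(c_{(−A)}−δ_B). -/

import Mathlib

open scoped Classical

/-- The modified multiple harmonic sum `ζ◇_N(k)` for an index given as a list. -/
noncomputable def zdiaL (N : ℕ) (k : List ℕ) : ℚ :=
  ∑ A : Finset (Fin k.length),
    if ∀ i ∈ A, k.get i = 1 then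
      ∑ n ∈ Finset.univ.filter (fun n : Fin k.length → Fin N =>
        (∀ i, 0 < (n i : ℕ)) ∧
        ∀ (i : Fin k.length) (h : (i : ℕ) + 1 < k.length),
          if i ∈ A then n i ≤ n ⟨(i : ℕ) + 1, h⟩ else n i < n ⟨(i : ℕ) + 1, h⟩),
        ∏ i : Fin k.length,
          if i ∈ A then (1 : ℚ) / ((N : ℚ) - ((n i : ℕ) : ℚ))
          else (1 : ℚ) / (((n i : ℕ) : ℚ) ^ k.get i)
    else 0

/-- The index `({1}^{c₁-1}, c₂+1, {1}^{c₃-1}, c₄+1, …)` built from an even-length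
tuple `c`. -/
def buildIdx : List ℕ → List ℕ
  | [] => []
  | [a] => List.replicate (a - 1) 1
  | a :: b :: rest => (List.replicate (a - 1) 1 ++ [b + 1]) ++ buildIdx rest

/-- `modifyIdx c A B` is the tuple `c_{(-A)} - δ_B`: remove the entries of `c` at the
(0-based) positions in `A`, and subtract `1` from each remaining entry whose original
position lies in `B`. -/
def modifyIdx (c : List ℕ) (A B : Finset ℕ) : List ℕ :=
  ((List.range c.length).filter (fun i => i ∉ A)).map
    (fun i => c.getD i 0 - (if i ∈ B then 1 else 0))

/-- `f_N(c) = ζ◇_N({1}^{c₁-1}, c₂+1, …, {1}^{c_{2s-1}-1}, c_{2s}+1)`. -/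
noncomputable def fN (N : ℕ) (c : List ℕ) : ℚ := zdiaL N (buildIdx c)

/-- The auxiliary sum `h_N(c)`.  Positions are 0-based (0-based position `i`
corresponds to the paper's position `i+1`), so even 0-based positions carry the
`1/(N - n)` factors and odd ones the `1/n` factors; the boundary value `n_{0,c₀}` of
the paper is read as `0`. -/
noncomputable def hN (N : ℕ) (c : List ℕ) : ℚ :=
  ∑ A : Finset (Fin c.length),
    if ∀ i ∈ A, c.get i = 1 then
      (1 / (N : ℚ)) ^ A.card *
      ∑ n ∈ Finset.univ.filter
        (fun n : ∀ i : Fin c.length, Fin (c.get i) → Fin N =>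
          (∀ i, Monotone (n i)) ∧
          (∀ (j : Fin c.length) (b : Fin (c.get j)), (b : ℕ) = 0 →
            if (j : ℕ) = 0 then
              (if j ∈ A then (n j b : ℕ) = 0 else 0 < (n j b : ℕ))
            else
              ∀ (j' : Fin c.length) (a : Fin (c.get j')),
                (j' : ℕ) + 1 = (j : ℕ) → (a : ℕ) + 1 = c.get j' →
                (if j ∈ A then (n j' a : ℕ) = (n j b : ℕ)
                 else (n j' a : ℕ) < (n j b : ℕ)))),
        ∏ i : Fin c.length, ∏ j : Fin (c.get i),
          if i ∈ A then 1
          else if (i : ℕ) % 2 = 0 then (1 : ℚ) / ((N : ℚ) - ((n i j : ℕ) : ℚ))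
          else (1 : ℚ) / ((n i j : ℕ) : ℚ)
    else 0

/-- 0-based translation of the paper's (1-based) *even-odd* condition: a union of
(1-based) pairs `{2r, 2r+1}`. -/
def EvenOddZ (A : Finset ℕ) : Prop :=
  ∀ i ∈ A, (i % 2 = 1 → i + 1 ∈ A) ∧ (i % 2 = 0 → 0 < i ∧ i - 1 ∈ A)

/-- 0-based translation of the paper's (1-based) *odd-even* condition: a union of
(1-based) pairs `{2r-1, 2r}`. -/
def OddEvenZ (A : Finset ℕ) : Prop :=
  ∀ i ∈ A, (i % 2 = 0 → i + 1 ∈ A) ∧ (i % 2 = 1 → i - 1 ∈ A)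

/-- `g_N(c) = f_{N+1}(c)`. -/
noncomputable def gN (N : ℕ) (c : List ℕ) : ℚ := fN (N + 1) c


/-! ### Linear operators -/

/-- `(opA N w f) k = w k * ∑_{k ≤ m ≤ N} f m`. -/
def opA (N : ℕ) (w : ℕ → ℚ) : Module.End ℚ (ℕ → ℚ) where
  toFun f := fun k => w k * ∑ m ∈ Finset.Icc k N, f m
  map_add' f g := by
    funext k; simp [Finset.sum_add_distrib, mul_add]
  map_smul' a f := by
    funext k; simp [← Finset.mul_sum]; ring

/-- `(opS N w f) k = w k * ∑_{k < m ≤ N} f m`. -/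
def opS (N : ℕ) (w : ℕ → ℚ) : Module.End ℚ (ℕ → ℚ) where
  toFun f := fun k => w k * ∑ m ∈ Finset.Ioc k N, f m
  map_add' f g := by
    funext k; simp [Finset.sum_add_distrib, mul_add]
  map_smul' a f := by
    funext k; simp [← Finset.mul_sum]; ring

/-- Total sum over `1 ≤ m ≤ N`. -/
def sgm (N : ℕ) : (ℕ → ℚ) →ₗ[ℚ] ℚ where
  toFun f := ∑ m ∈ Finset.Icc 1 N, f m
  map_add' f g := by simp [Finset.sum_add_distrib]
  map_smul' a f := by simp [← Finset.mul_sum]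

def wY (k : ℕ) : ℚ := 1 / (k : ℚ)
def wX (N k : ℕ) : ℚ := if k = 0 then 0 else 1 / ((N : ℚ) - (k : ℚ))
def wM (N k : ℕ) : ℚ := 1 / ((N : ℚ) + 1 - (k : ℚ))
def dl (N : ℕ) : ℕ → ℚ := fun k => if k = N then 1 else 0

theorem opA_apply (N : ℕ) (w f) (k) : opA N w f k = w k * ∑ m ∈ Finset.Icc k N, f m := rfl
theorem opS_apply (N : ℕ) (w f) (k) : opS N w f k = w k * ∑ m ∈ Finset.Ioc k N, f m := rfl
theorem sgm_apply (N : ℕ) (f) : sgm N f = ∑ m ∈ Finset.Icc 1 N, f m := rfl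

theorem shift_sum (N : ℕ) (f : ℕ → ℚ) (k : ℕ) (hk : 0 < k) :
    ∑ m ∈ Finset.Ioc k N, opA N (wM N) f m = ∑ m ∈ Finset.Icc k N, opS N (wX N) f m := by
  have h1 : ∀ m, 0 < m → opS N (wX N) f m = opA N (wM N) f (m+1) := by
    intro m hm
    rw [opA_apply, opS_apply]
    have : Finset.Icc (m+1) N = Finset.Ioc m N := by
      ext; simp only [Finset.mem_Icc, Finset.mem_Ioc]; omega
    rw [this, wX, wM, if_neg (by omega)]
    congr 2; push_cast; ring
  by_cases hkN : k ≤ N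
  · have : ∑ m ∈ Finset.Icc k N, opS N (wX N) f m = ∑ m ∈ Finset.Icc k N, opA N (wM N) f (m+1) :=
      Finset.sum_congr rfl (fun m hm => h1 m (by simp at hm; omega))
    rw [this]
    have h2 : opA N (wM N) f (N+1) = 0 := by simp [opA_apply]
    have h3 : ∑ m ∈ Finset.Icc k N, opA N (wM N) f (m+1)
        = ∑ m ∈ Finset.Ioc k (N+1), opA N (wM N) f m := by
      apply Finset.sum_bij (fun m _ => m+1)
      · intro a ha; simp at *; omega
      · intro a _ b _ h; omega
      · intro b hb; simp at hb; exact ⟨b-1, by simp; omega, by omega⟩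
      · intros; rfl
    have h4 : Finset.Ioc k (N+1) = insert (N+1) (Finset.Ioc k N) := by ext; simp; omega
    rw [h3, h4, Finset.sum_insert (by simp), h2, zero_add]
  · rw [Finset.Ioc_eq_empty (by omega), Finset.Icc_eq_empty (by omega)]; simp

theorem y_mm (N : ℕ) : opS N wY * opA N (wM N) = opA N wY * opS N (wX N) := by
  ext1 f; funext k
  simp only [Module.End.mul_apply]
  rw [opS_apply, opA_apply N wY]
  rcases Nat.eq_zero_or_pos k with rfl | hk
  · simp [wY]
  · rw [shift_sum N f k hk]

theorem q_mm (N : ℕ) :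
    opS N (wX N) * opA N (wM N) = opA N (wX N) * opS N (wX N) := by
  ext1 f; funext k
  simp only [Module.End.mul_apply]
  rw [opS_apply, opA_apply N (wX N)]
  rcases Nat.eq_zero_or_pos k with rfl | hk
  · simp [wX]
  · rw [shift_sum N f k hk]

theorem q_mm_pow (N j : ℕ) :
    opS N (wX N) * opA N (wM N) ^ j = opA N (wX N) ^ j * opS N (wX N) := by
  induction j with
  | zero => simp
  | succ j ih => rw [pow_succ, ← mul_assoc, ih, mul_assoc, q_mm, ← mul_assoc, ← pow_succ]

theorem sum_Icc_head (N k : ℕ) (h : k ≤ N) (f : ℕ → ℚ) :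
    ∑ m ∈ Finset.Icc k N, f m = f k + ∑ m ∈ Finset.Ioc k N, f m := by
  have : Finset.Icc k N = insert k (Finset.Ioc k N) := by ext; simp; omega
  rw [this, Finset.sum_insert (by simp)]

theorem y_q (N : ℕ) (hN : 0 < N) : opS N wY * opS N (wX N) =
    opA N wY * opS N (wX N) - (1 / (N : ℚ)) • (opS N wY + opS N (wX N)) := by
  ext1 f; funext k
  simp only [Module.End.mul_apply, LinearMap.sub_apply, LinearMap.smul_apply, LinearMap.add_apply,
    Pi.sub_apply, Pi.smul_apply, Pi.add_apply, smul_eq_mul]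
  have hN' : (N : ℚ) ≠ 0 := by positivity
  rcases Nat.eq_zero_or_pos k with rfl | hk
  · simp [opS_apply, opA_apply, wY, wX]
  · by_cases hkN : k < N
    · rw [opS_apply, opA_apply, sum_Icc_head N k hkN.le, opS_apply N (wX N) f k, opS_apply N wY f k]
      generalize ∑ m ∈ Finset.Ioc k N, f m = F
      generalize ∑ m ∈ Finset.Ioc k N, (opS N (wX N)) f m = G
      rw [wX, wY, if_neg (by omega)]
      have h1 : (k : ℚ) ≠ 0 := by positivity
      have h2 : (N : ℚ) - k ≠ 0 := by
        have : (k : ℚ) < N := by exact_mod_cast hkN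
        linarith
      field_simp; ring
    · rw [opS_apply, opA_apply, opS_apply N (wX N) f k, opS_apply N wY f k,
        Finset.Ioc_eq_empty (by omega)]
      simp only [Finset.sum_empty, mul_zero, add_zero, sub_zero]
      by_cases h : k = N
      · subst h; simp [opS_apply]
      · rw [Finset.Icc_eq_empty (by omega)]; simp

theorem y_dl (N : ℕ) (hN : 0 < N) :
    opS N wY (dl N) = opA N wY (dl N) - (1 / (N : ℚ)) • dl N := by
  funext k
  simp only [Pi.sub_apply, Pi.smul_apply, smul_eq_mul]
  rw [opS_apply, opA_apply]
  simp only [dl, Finset.sum_ite_eq', Finset.mem_Ioc, Finset.mem_Icc, le_refl, and_true]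
  by_cases h : k = N
  · subst h; simp [wY]
  · by_cases h2 : k < N
    · simp [h, h2, h2.le]
    · have : ¬ k ≤ N := by omega
      simp [h, h2, this]

theorem sgm_q (N : ℕ) (hN : 0 < N) (f : ℕ → ℚ) :
    sgm N (opS N (wX N) f) = sgm N (opA N (wM N) f) - (1 / (N : ℚ)) * sgm N f := by
  rw [sgm_apply, sgm_apply, sgm_apply, ← shift_sum N f 1 one_pos,
    sum_Icc_head N 1 hN (fun m => opA N (wM N) f m), opA_apply]
  simp [wM]

/-! ### The vectors attached to lists -/

mutual
noncomputable def etX (N : ℕ) : List ℕ → (ℕ → ℚ)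
  | [] => dl N
  | a :: cs => (opS N (wX N) * opA N (wM N) ^ (a - 1) +
      (if a = 1 then (1 / (N : ℚ)) • 1 else 0)) (etY N cs)
noncomputable def etY (N : ℕ) : List ℕ → (ℕ → ℚ)
  | [] => dl N
  | b :: cs => (opA N wY ^ (b - 1) * opS N wY +
      (if b = 1 then (1 / (N : ℚ)) • 1 else 0)) (etX N cs)
end

mutual
noncomputable def gaX (N : ℕ) : List ℕ → (ℕ → ℚ)
  | [] => dl N
  | a :: cs => (opS N (wX N) * opA N (wM N) ^ (a - 1)) (gaY N cs)
noncomputable def gaY (N : ℕ) : List ℕ → (ℕ → ℚ)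
  | [] => dl N
  | b :: cs => (opA N wY ^ b) (gaX N cs)
end

/-- recursive form of the signed sum, for lists starting at an odd (0-based) position -/
noncomputable def KK (N : ℕ) : List ℕ → (List ℕ → ℚ) → ℚ
  | [], _ => 0
  | [b], Φ => Φ [b] + (if 2 ≤ b then - (1 / (N : ℚ)) * Φ [b - 1] else 0)
  | b :: a :: cs, Φ =>
      KK N cs (fun l => Φ (b :: a :: l))
      + (if 2 ≤ a then - (1 / (N : ℚ)) * KK N cs (fun l => Φ (b :: (a - 1) :: l)) else 0)
      + (if 2 ≤ b then - (1 / (N : ℚ)) * KK N cs (fun l => Φ ((b - 1) :: a :: l)) else 0)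
      + (if b = 1 ∧ a = 1 then (1 / (N : ℚ)) ^ 2 * KK N cs Φ else 0)

theorem KK_congr (N : ℕ) : ∀ (d : List ℕ), d.length % 2 = 1 → (∀ x ∈ d, 0 < x) →
    ∀ (Φ Ψ : List ℕ → ℚ),
    (∀ l : List ℕ, l.length % 2 = 1 → (∀ x ∈ l, 0 < x) → Φ l = Ψ l) → KK N d Φ = KK N d Ψ
  | [], h, _ => by simp at h
  | [b], _, hp => by
      intro Φ Ψ H
      have hb : 0 < b := hp b (by simp)
      rw [KK, KK, H [b] (by simp) (by simpa using hb)]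
      congr 1
      split_ifs with h
      · rw [H [b-1] (by simp) (by simp; omega)]
      · rfl
  | b :: a :: cs, h, hp => by
      intro Φ Ψ H
      have hb : 0 < b := hp b (by simp)
      have ha : 0 < a := hp a (by simp)
      have hcs : ∀ x ∈ cs, 0 < x := fun x hx => hp x (by simp [hx])
      have hl : cs.length % 2 = 1 := by simp at h; omega
      have ih := KK_congr N cs hl hcs
      have key : ∀ b' a', 0 < b' → 0 < a' → KK N cs (fun l => Φ (b' :: a' :: l))
          = KK N cs (fun l => Ψ (b' :: a' :: l)) := by
        intro b' a' hb' ha'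
        apply ih
        intro l hl hp
        apply H
        · simp; omega
        · intro x hx; simp at hx; rcases hx with rfl | rfl | hx
          · exact hb'
          · exact ha'
          · exact hp x hx
      rw [KK, KK, key b a hb ha, ih Φ Ψ H]
      congr 2
      · congr 1
        split_ifs
        · rw [key b (a-1) hb (by omega)]
        · rfl
      · split_ifs
        · rw [key (b-1) a (by omega) ha]
        · rfl

theorem block_id (N : ℕ) (hN : 0 < N) (a b : ℕ) (ha : 0 < a) (hb : 0 < b) :
    (opA N wY ^ (b - 1) * opS N wY + (if b = 1 then (1 / (N : ℚ)) • 1 else 0)) *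
    (opS N (wX N) * opA N (wM N) ^ (a - 1) + (if a = 1 then (1 / (N : ℚ)) • 1 else 0)) =
    opA N wY ^ b * (opS N (wX N) * opA N (wM N) ^ (a - 1))
    + (if 2 ≤ a then - (1 / (N : ℚ)) •
        (opA N wY ^ b * (opS N (wX N) * opA N (wM N) ^ (a - 1 - 1))) else 0)
    + (if 2 ≤ b then - (1 / (N : ℚ)) •
        (opA N wY ^ (b - 1) * (opS N (wX N) * opA N (wM N) ^ (a - 1))) else 0)
    + (if b = 1 ∧ a = 1 then (1 / (N : ℚ)) ^ 2 • 1 else 0) := by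
  have h1 := y_q N hN
  have h2 := y_mm N
  generalize opS N wY = y at *
  generalize opS N (wX N) = q at *
  generalize opA N wY = p at *
  generalize opA N (wM N) = m at *
  generalize (1 / (N : ℚ)) = t at *
  obtain ⟨a, rfl⟩ : ∃ a', a = a' + 1 := ⟨a - 1, by omega⟩
  obtain ⟨b, rfl⟩ : ∃ b', b = b' + 1 := ⟨b - 1, by omega⟩
  have e1 : ∀ u v, u * y * (q * v) = u * (p * q) * v - t • (u * y * v) - t • (u * q * v) := by
    intro u v
    have : u * y * (q * v) = u * (y * q) * v := by simp only [mul_assoc]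
    rw [this, h1]
    simp only [mul_sub, sub_mul, mul_smul_comm, smul_mul_assoc, mul_add, add_mul, smul_add]
    abel
  rcases a with _ | a <;> rcases b with _ | b
  · have := e1 1 1
    simp only [one_mul, mul_one] at this
    simp only [zero_add, pow_zero, mul_one, one_mul, Nat.sub_self, if_true, mul_add, add_mul, this,
      pow_one]
    simp [smul_smul, pow_two]
    abel
  · have := e1 (p ^ (b+1)) 1
    simp only [mul_one] at this
    simp [mul_add, this]
    simp only [pow_succ, mul_assoc]
    module
  · have := e1 1 (m ^ (a+1))
    simp only [one_mul] at this
    have h3 : y * m ^ (a + 1) = p * q * m ^ a := by rw [pow_succ', ← mul_assoc, h2]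
    simp [add_mul, this, h3]
    simp only [mul_assoc]
    module
  · have := e1 (p ^ (b+1)) (m ^ (a+1))
    have h3 : p ^ (b+1) * y * m ^ (a + 1) = p ^ (b+1) * p * q * m ^ a := by
      rw [pow_succ' m, ← mul_assoc, mul_assoc _ y, h2]; simp only [mul_assoc]
    simp [this, h3]
    simp only [pow_succ, mul_assoc]
    module

theorem KK_ga (N : ℕ) (hN : 0 < N) : ∀ (d : List ℕ), d.length % 2 = 1 → (∀ x ∈ d, 0 < x) →
    ∀ ℓ : (ℕ → ℚ) →ₗ[ℚ] ℚ, KK N d (fun l => ℓ (gaY N l)) = ℓ (etY N d)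
  | [], h, _ => by simp at h
  | [b], _, hp => by
      intro ℓ
      have hb : 0 < b := hp b (by simp)
      obtain ⟨b, rfl⟩ : ∃ b', b = b' + 1 := ⟨b - 1, by omega⟩
      simp only [KK, gaY, gaX, etY, etX, LinearMap.add_apply, Module.End.mul_apply]
      rw [y_dl N hN]
      rcases b with _ | b
      · simp
      · simp [pow_succ]; ring
  | b :: a :: cs, h, hp => by
      intro ℓ
      have hb : 0 < b := hp b (by simp)
      have ha : 0 < a := hp a (by simp)
      have hcs : ∀ x ∈ cs, 0 < x := fun x hx => hp x (by simp [hx])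
      have hl : cs.length % 2 = 1 := by simp at h; omega
      have ih := KK_ga N hN cs hl hcs
      have key : ∀ b' a', KK N cs (fun l => ℓ (gaY N (b' :: a' :: l)))
          = ℓ ((opA N wY ^ b' * (opS N (wX N) * opA N (wM N) ^ (a' - 1))) (etY N cs)) := by
        intro b' a'
        have := ih (ℓ ∘ₗ (opA N wY ^ b' * (opS N (wX N) * opA N (wM N) ^ (a' - 1))))
        simpa [gaY, gaX] using this
      rw [KK, key, key, key, ih ℓ]
      have : etY N (b :: a :: cs) = ((opA N wY ^ (b - 1) * opS N wY +
          (if b = 1 then (1 / (N : ℚ)) • 1 else 0)) *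
        (opS N (wX N) * opA N (wM N) ^ (a - 1) +
          (if a = 1 then (1 / (N : ℚ)) • 1 else 0))) (etY N cs) := by
        simp only [etY, etX, Module.End.mul_apply]
      rw [this, block_id N hN a b ha hb]
      simp only [LinearMap.add_apply, map_add]
      congr 1
      · congr 1
        · congr 1
          split_ifs <;> simp
        · split_ifs <;> simp
      · split_ifs <;> simp

theorem sgm_first (N : ℕ) (hN : 0 < N) (a : ℕ) (ha : 0 < a) (f : ℕ → ℚ) :
    sgm N ((opS N (wX N) * opA N (wM N) ^ (a - 1) +
      (if a = 1 then (1 / (N : ℚ)) • 1 else 0)) f) =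
    sgm N ((opA N (wM N) ^ a) f) +
      (if 2 ≤ a then - (1 / (N : ℚ)) * sgm N ((opA N (wM N) ^ (a - 1)) f) else 0) := by
  obtain ⟨a, rfl⟩ : ∃ a', a = a' + 1 := ⟨a - 1, by omega⟩
  simp only [LinearMap.add_apply, map_add, Module.End.mul_apply, sgm_q N hN, pow_succ' _ a]
  rcases a with _ | a
  · simp
  · simp; ring

/-! ### The binomial kernel -/

def ee (N n m : ℕ) : ℚ := (m.choose n : ℚ) / (N.choose n : ℚ)

theorem ee_ne (N n : ℕ) (h : n ≤ N) : (N.choose n : ℚ) ≠ 0 := by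
  exact_mod_cast (Nat.choose_pos h).ne'

theorem choose_succ_q (m n : ℕ) :
    ((m.choose (n+1) : ℕ) : ℚ) * ((n : ℚ) + 1) = (m.choose n : ℚ) * ((m : ℚ) - n) := by
  by_cases h : n ≤ m
  · have := Nat.choose_succ_right_eq m n
    have h2 : ((m - n : ℕ) : ℚ) = (m : ℚ) - n := by push_cast [h]; ring
    rw [← h2]; exact_mod_cast this
  · rw [Nat.choose_eq_zero_of_lt (by omega), Nat.choose_eq_zero_of_lt (by omega)]; simp

/-- difference of the kernel -/
theorem ee_diff (N n m : ℕ) (h : n + 1 ≤ N) :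
    ee N (n+1) (m+1) - ee N (n+1) m = ((n : ℚ) + 1) / ((N : ℚ) - n) * ee N n m := by
  have h1 := ee_ne N n (by omega)
  have h2 := ee_ne N (n+1) h
  have h3 : (N : ℚ) - n ≠ 0 := by
    have : (n : ℚ) + 1 ≤ N := by exact_mod_cast h
    linarith
  have h4 := choose_succ_q N n
  have h5 : ((m+1).choose (n+1) : ℚ) = m.choose n + m.choose (n+1) := by
    exact_mod_cast Nat.choose_succ_succ m n
  rw [ee, ee, ee, h5]
  field_simp
  linear_combination (- (m.choose n : ℚ)) * h4

theorem ee_diff2 (N n m : ℕ) (h : n + 1 ≤ N) (hm : m < N) :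
    (ee N (n+1) (m+1) - ee N (n+1) m) / ((n : ℚ) + 1)
      = (ee N n m - ee N (n+1) m) / ((N : ℚ) - m) := by
  rw [ee_diff N n m h]
  have h1 := ee_ne N n (by omega)
  have h2 := ee_ne N (n+1) h
  have h3 : (N : ℚ) - n ≠ 0 := by
    have : (n : ℚ) + 1 ≤ N := by exact_mod_cast h
    linarith
  have h3' : (N : ℚ) - m ≠ 0 := by
    have : (m : ℚ) + 1 ≤ N := by exact_mod_cast hm
    linarith
  have h4 := choose_succ_q N n
  have h5 := choose_succ_q m n
  have h6 : ((n : ℚ) + 1) ≠ 0 := by positivity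
  have h7 : ee N (n+1) m * ((N : ℚ) - n) = ee N n m * ((m : ℚ) - n) := by
    rw [ee, ee]
    field_simp
    apply mul_right_cancel₀ h6
    linear_combination (N.choose n : ℚ) * ((N : ℚ) - n) * h5 - (m.choose n : ℚ) * ((m : ℚ) - n) * h4
  field_simp
  linear_combination h7

theorem ee_zero_right (N n : ℕ) (h : 0 < n) : ee N n 0 = 0 := by
  rw [ee, Nat.choose_eq_zero_of_lt h]; simp

theorem ee_zero_left (N m : ℕ) : ee N 0 m = 1 := by simp [ee]

theorem tele (N n k : ℕ) (hk : k < N) (hn : n ≤ N) :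
    ∑ j ∈ Finset.Ioc n N, (ee N j (k+1) - ee N j k) / (j : ℚ) = ee N n k / ((N : ℚ) - k) := by
  have h0 : ee N N k = 0 := by rw [ee, Nat.choose_eq_zero_of_lt hk]; simp
  have key : ∀ M, n ≤ M → M ≤ N →
      ∑ j ∈ Finset.Ioc n M, (ee N j (k+1) - ee N j k) / (j : ℚ)
        = (ee N n k - ee N M k) / ((N : ℚ) - k) := by
    intro M hM
    induction M, hM using Nat.le_induction with
    | base => intro; simp
    | succ M hM ih =>
      intro h
      have : Finset.Ioc n (M+1) = insert (M+1) (Finset.Ioc n M) := by ext; simp; omega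
      rw [this, Finset.sum_insert (by simp), ih (by omega)]
      push_cast
      rw [ee_diff2 N M k h hk]; ring
  rw [key N hn le_rfl, h0, sub_zero]

theorem eQ (N n m : ℕ) (hn : n ≤ N) (hm : m ≤ N) :
    ∑ k ∈ Finset.range m, ee N n k / ((N : ℚ) - k) = ∑ j ∈ Finset.Ioc n N, ee N j m / (j : ℚ) := by
  induction m with
  | zero =>
    rw [Finset.range_zero, Finset.sum_empty, Finset.sum_eq_zero]
    intro j hj
    simp at hj
    rw [ee_zero_right N j (by omega)]; simp
  | succ m ih =>
    rw [Finset.sum_range_succ, ih (by omega), ← tele N n m (by omega) hn, ← Finset.sum_add_distrib]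
    apply Finset.sum_congr rfl
    intros; ring

theorem eP (N n m : ℕ) (hn : 0 < n) (hn' : n ≤ N) :
    ∑ k ∈ Finset.Icc 1 m, ee N n k / (k : ℚ) = ee N n m / (n : ℚ) := by
  obtain ⟨n, rfl⟩ : ∃ n', n = n' + 1 := ⟨n - 1, by omega⟩
  induction m with
  | zero => simp [ee_zero_right]
  | succ m ih =>
    rw [Finset.sum_Icc_succ_top (by omega), ih, ee, ee]
    have h1 : ((m : ℚ) + 1) ≠ 0 := by positivity
    have h2 : ((n : ℚ) + 1) ≠ 0 := by positivity
    have h3 := ee_ne N (n+1) hn'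
    have h4 : ((m : ℚ) + 1) * m.choose n = (m+1).choose (n+1) * ((n : ℚ) + 1) := by
      exact_mod_cast Nat.add_one_mul_choose_eq m n
    have h5 : ((m+1).choose (n+1) : ℚ) = m.choose n + m.choose (n+1) := by
      exact_mod_cast Nat.choose_succ_succ m n
    push_cast
    field_simp
    linear_combination (-1 : ℚ) * h4 - ((m : ℚ) + 1) * h5

theorem eM (N n m : ℕ) (hn : 0 < n) (hn' : n ≤ N) (hm : m ≤ N) :
    ∑ k ∈ Finset.Icc 1 m, ee N n k / ((N : ℚ) + 1 - k) =
      ((N : ℚ) + 1) / ((N : ℚ) + 1 - n) * ∑ j ∈ Finset.Ioc n N, ee N j m / (j : ℚ)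
      + ee N n m / ((N : ℚ) + 1 - n) := by
  obtain ⟨n, rfl⟩ : ∃ n', n = n' + 1 := ⟨n - 1, by omega⟩
  have h1 : ∑ k ∈ Finset.Icc 1 m, ee N (n+1) k / ((N : ℚ) + 1 - k)
      = ∑ k ∈ Finset.range m, ee N (n+1) (k+1) / ((N : ℚ) - k) := by
    symm
    apply Finset.sum_bij (fun k _ => k+1)
    · intro a ha; simp at *; omega
    · intro a _ b _ h; omega
    · intro b hb; simp at hb; exact ⟨b-1, by simp; omega, by omega⟩
    · intro a _; push_cast; congr 1; ring
  have h2 : ∀ k, ee N (n+1) (k+1) / ((N : ℚ) - k) = ee N (n+1) k / ((N : ℚ) - k)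
      + ((n : ℚ) + 1) / ((N : ℚ) - n) * (ee N n k / ((N : ℚ) - k)) := by
    intro k
    have := ee_diff N n k hn'
    have h : ee N (n+1) (k+1) = ee N (n+1) k + ((n : ℚ) + 1) / ((N : ℚ) - n) * ee N n k := by
      linarith
    rw [h]; ring
  rw [h1, Finset.sum_congr rfl (fun k _ => h2 k), Finset.sum_add_distrib, ← Finset.mul_sum,
    eQ N (n+1) m hn' hm, eQ N n m (by omega) hm]
  have h3 : Finset.Ioc n N = insert (n+1) (Finset.Ioc (n+1) N) := by ext; simp; omega
  rw [h3, Finset.sum_insert (by simp)]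
  have h4 : (N : ℚ) - n ≠ 0 := by
    have : (n : ℚ) + 1 ≤ N := by exact_mod_cast hn'
    linarith
  have h6 : ((n : ℚ) + 1) ≠ 0 := by positivity
  generalize ∑ j ∈ Finset.Ioc (n+1) N, ee N j m / (j : ℚ) = G
  push_cast
  have h7 : (N : ℚ) + 1 - (n + 1) = N - n := by ring
  rw [h7]
  field_simp
  ring

/-- the transfer map -/
def tt (N : ℕ) (f : ℕ → ℚ) (n : ℕ) : ℚ := ∑ m ∈ Finset.Icc 1 N, f m * ee N n m

theorem sum_swap_A (N : ℕ) (w f u : ℕ → ℚ) :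
    ∑ k ∈ Finset.Icc 1 N, opA N w f k * u k
      = ∑ m ∈ Finset.Icc 1 N, f m * ∑ k ∈ Finset.Icc 1 m, u k * w k := by
  simp only [opA_apply, Finset.mul_sum, Finset.sum_mul]
  rw [Finset.sum_sigma', Finset.sum_sigma']
  refine Finset.sum_bij' (fun x _ => ⟨x.2, x.1⟩) (fun x _ => ⟨x.2, x.1⟩) ?_ ?_ ?_ ?_ ?_
  · rintro ⟨a, b⟩ h; simp at *; omega
  · rintro ⟨a, b⟩ h; simp at *; omega
  · rintro ⟨a, b⟩ h; rfl
  · rintro ⟨a, b⟩ h; rfl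
  · rintro ⟨a, b⟩ h; simp; ring

theorem sum_swap_S (N : ℕ) (w f u : ℕ → ℚ) :
    ∑ k ∈ Finset.Icc 1 N, opS N w f k * u k
      = ∑ m ∈ Finset.Icc 1 N, f m * ∑ k ∈ Finset.Ico 1 m, u k * w k := by
  simp only [opS_apply, Finset.mul_sum, Finset.sum_mul]
  rw [Finset.sum_sigma', Finset.sum_sigma']
  refine Finset.sum_bij' (fun x _ => ⟨x.2, x.1⟩) (fun x _ => ⟨x.2, x.1⟩) ?_ ?_ ?_ ?_ ?_
  · rintro ⟨a, b⟩ h; simp at *; omega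
  · rintro ⟨a, b⟩ h; simp at *; omega
  · rintro ⟨a, b⟩ h; rfl
  · rintro ⟨a, b⟩ h; rfl
  · rintro ⟨a, b⟩ h; simp; ring

theorem tt_P (N : ℕ) (f) (n : ℕ) (hn : 0 < n) (hn' : n ≤ N) :
    tt N (opA N wY f) n = 1 / (n : ℚ) * tt N f n := by
  rw [tt, tt, sum_swap_A, Finset.mul_sum]
  apply Finset.sum_congr rfl
  intro m _
  have := eP N n m hn hn'
  simp only [wY, mul_one_div, this]; ring

theorem tt_Ppow (N : ℕ) (f) (n : ℕ) (hn : 0 < n) (hn' : n ≤ N) (b : ℕ) :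
    tt N ((opA N wY ^ b) f) n = 1 / (n : ℚ) ^ b * tt N f n := by
  induction b with
  | zero => simp
  | succ b ih =>
    rw [pow_succ', Module.End.mul_apply, tt_P N _ n hn hn', ih]
    rw [pow_succ]; field_simp

theorem tt_sum (N : ℕ) (f) (s : Finset ℕ) (u : ℕ → ℚ) : ∑ j ∈ s, u j * tt N f j
    = ∑ m ∈ Finset.Icc 1 N, f m * ∑ j ∈ s, u j * ee N j m := by
  simp only [tt, Finset.mul_sum]
  rw [Finset.sum_comm]
  apply Finset.sum_congr rfl; intros
  apply Finset.sum_congr rfl; intros; ring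

theorem tt_M (N : ℕ) (f) (n : ℕ) (hn : 0 < n) (hn' : n ≤ N) :
    tt N (opA N (wM N) f) n =
      ((N : ℚ) + 1) / ((N : ℚ) + 1 - n) * ∑ j ∈ Finset.Ioc n N, 1 / (j : ℚ) * tt N f j
      + 1 / ((N : ℚ) + 1 - n) * tt N f n := by
  rw [tt_sum, tt, tt, sum_swap_A, Finset.mul_sum, Finset.mul_sum, ← Finset.sum_add_distrib]
  apply Finset.sum_congr rfl
  intro m hm
  have := eM N n m hn hn' (by simp at hm; omega)
  simp only [wM, mul_one_div, this, one_div_mul_eq_div]; ring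

theorem tt_Q (N : ℕ) (f) (n : ℕ) (hn : 0 < n) (hn' : n ≤ N) :
    tt N (opS N (wX N) f) n = ∑ j ∈ Finset.Ioc n N, 1 / (j : ℚ) * tt N f j := by
  rw [tt_sum, tt, sum_swap_S]
  apply Finset.sum_congr rfl
  intro m hm
  simp at hm
  have := eQ N n m hn' (by omega)
  simp only [one_div_mul_eq_div, ← this]
  congr 1
  have h3 : Finset.range m = insert 0 (Finset.Ico 1 m) := by ext; simp; omega
  rw [h3, Finset.sum_insert (by simp), ee_zero_right N n hn]
  simp only [zero_div, zero_add]
  apply Finset.sum_congr rfl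
  intro k hk
  simp at hk
  rw [wX, if_neg (by omega), mul_one_div]

theorem tt_zero (N : ℕ) (f) :
    ∑ j ∈ Finset.Ioc 0 N, 1 / (j : ℚ) * tt N f j = sgm N (opA N (wM N) f) := by
  rw [tt_sum, sgm_apply]
  have := sum_swap_A N (wM N) f (fun _ => 1)
  simp only [mul_one, one_mul] at this
  rw [this]
  apply Finset.sum_congr rfl
  intro m hm
  simp at hm
  have := eQ N 0 m (by omega) (by omega)
  simp only [one_div_mul_eq_div, ← this]
  congr 1
  apply Finset.sum_bij (fun k _ => k+1)
  · intro a ha; simp at *; omega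
  · intro a _ b _ h; omega
  · intro b hb; simp at hb; exact ⟨b-1, by simp; omega, by omega⟩
  · intro a _; rw [ee_zero_left, wM]; push_cast; congr 1; ring

theorem tt_dl (N : ℕ) (hN : 0 < N) (n : ℕ) (hn : n ≤ N) : tt N (dl N) n = 1 := by
  have : (1 ≤ N ∧ N ≤ N) := ⟨hN, le_rfl⟩
  simp only [tt, dl, ite_mul, one_mul, zero_mul, Finset.sum_ite_eq', Finset.mem_Icc, this]
  rw [if_pos (by simp), ee, div_self (ee_ne N n hn)]

/-! ### Recursive form of the diamond sum -/

noncomputable def ZZ (N : ℕ) : List ℕ → ℕ → ℚ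
  | [], _ => 1
  | k :: ks, p => ∑ n ∈ Finset.Ioc p N,
      ((if k = 1 then 1 / ((N : ℚ) + 1 - n) * ZZ N ks (n - 1) else 0)
        + 1 / (n : ℚ) ^ k * ZZ N ks n)

theorem ZZ_block (N : ℕ) (f : ℕ → ℚ) (b : ℕ) (hb : 0 < b) (ks : List ℕ)
    (H : ∀ n, 0 < n → n ≤ N → ZZ N ks n = tt N f n) (j : ℕ) : ∀ p,
    ZZ N (List.replicate j 1 ++ (b + 1) :: ks) p
      = ∑ n ∈ Finset.Ioc p N, 1 / (n : ℚ) * tt N ((opA N (wM N) ^ j) ((opA N wY ^ b) f)) n := by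
  induction j with
  | zero =>
    intro p
    simp only [List.replicate_zero, List.nil_append, ZZ, pow_zero, Module.End.one_apply]
    apply Finset.sum_congr rfl
    intro n hn
    simp at hn
    rw [if_neg (by omega), tt_Ppow N f n (by omega) (by omega), H n (by omega) (by omega), pow_succ]
    field_simp; ring
  | succ j ih =>
    intro p
    rw [List.replicate_succ, List.cons_append, ZZ]
    apply Finset.sum_congr rfl
    intro n hn
    simp at hn
    rw [ih, ih, if_pos rfl, pow_succ' (opA N (wM N)), Module.End.mul_apply, tt_M N _ n (by omega) (by omega)]
    have h3 : Finset.Ioc (n-1) N = insert n (Finset.Ioc n N) := by ext; simp; omega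
    rw [h3, Finset.sum_insert (by simp)]
    generalize tt N ((opA N (wM N) ^ j) ((opA N wY ^ b) f)) n = T
    generalize ∑ x ∈ Finset.Ioc n N,
      1 / (x : ℚ) * tt N ((opA N (wM N) ^ j) ((opA N wY ^ b) f)) x = G
    have h4 : (N : ℚ) + 1 - n ≠ 0 := by
      have : (n : ℚ) ≤ N := by exact_mod_cast hn.2
      linarith
    have h5 : (n : ℚ) ≠ 0 := by
      have : 0 < n := by omega
      positivity
    field_simp; ring

theorem ZZ_ga (N : ℕ) (hN : 0 < N) : ∀ (c : List ℕ), c.length % 2 = 0 → (∀ x ∈ c, 0 < x) →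
    ∀ n, 0 < n → n ≤ N → ZZ N (buildIdx c) n = tt N (gaX N c) n
  | [], _, _ => by
      intro n _ hn
      rw [buildIdx, ZZ, gaX, tt_dl N hN n hn]
  | [a], h, _ => by simp at h
  | a :: b :: cs, h, hp => by
      intro n hn hn'
      have hb : 0 < b := hp b (by simp)
      have ih := ZZ_ga N hN cs (by simp at h; omega) (fun x hx => hp x (by simp [hx]))
      have := ZZ_block N (gaX N cs) b hb (buildIdx cs) ih (a-1) n
      rw [← tt_Q N _ n hn hn'] at this
      simpa [buildIdx, gaX, gaY] using this

theorem ZZ_zero (N : ℕ) (hN : 0 < N) (a : ℕ) (d : List ℕ) (hd : d.length % 2 = 1) (ha : 0 < a)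
    (hp : ∀ x ∈ d, 0 < x) :
    ZZ N (buildIdx (a :: d)) 0 = sgm N ((opA N (wM N) ^ a) (gaY N d)) := by
  rcases d with _ | ⟨b, cs⟩
  · simp at hd
  · have hb : 0 < b := hp b (by simp)
    have ih := ZZ_ga N hN cs (by simp at hd; omega) (fun x hx => hp x (by simp [hx]))
    have := ZZ_block N (gaX N cs) b hb (buildIdx cs) ih (a-1) 0
    rw [tt_zero] at this
    obtain ⟨a, rfl⟩ : ∃ a', a = a' + 1 := ⟨a - 1, by omega⟩
    simpa [buildIdx, gaX, gaY, pow_succ'] using this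

/-! ### Peeling the sum over pairs of subsets -/

def cn (x : Bool) (A : Finset ℕ) : Finset ℕ :=
  if x then insert 0 (A.map ⟨Nat.succ, Nat.succ_injective⟩)
  else A.map ⟨Nat.succ, Nat.succ_injective⟩

theorem zero_mem_cn (x : Bool) (A : Finset ℕ) : 0 ∈ cn x A ↔ x = true := by
  cases x <;> simp [cn]

theorem succ_mem_cn (x : Bool) (A : Finset ℕ) (i : ℕ) : i + 1 ∈ cn x A ↔ i ∈ A := by
  cases x <;> simp [cn]

theorem card_cn (x : Bool) (A : Finset ℕ) : (cn x A).card = A.card + x.toNat := by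
  cases x <;> simp [cn]

theorem forall_cn (x : Bool) (A : Finset ℕ) (P : ℕ → Prop) :
    (∀ i ∈ cn x A, P i) ↔ (x = true → P 0) ∧ ∀ i ∈ A, P (i + 1) := by
  constructor
  · intro h
    exact ⟨fun hx => h 0 ((zero_mem_cn x A).2 hx), fun i hi => h _ ((succ_mem_cn x A i).2 hi)⟩
  · rintro ⟨h0, h1⟩ i hi
    rcases i with _ | i
    · exact h0 ((zero_mem_cn x A).1 hi)
    · exact h1 i ((succ_mem_cn x A i).1 hi)

theorem cn_surj (A : Finset ℕ) : A = cn (decide (0 ∈ A)) ((A.erase 0).image Nat.pred) := by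
  ext i
  rcases i with _ | i
  · simp [zero_mem_cn]
  · simp only [succ_mem_cn, Finset.mem_image, Finset.mem_erase]
    constructor
    · intro h; exact ⟨i+1, ⟨by omega, h⟩, by simp⟩
    · rintro ⟨j, ⟨h1, h2⟩, h3⟩
      have : j = i + 1 := by
        rw [Nat.pred_eq_sub_one] at h3; omega
      rwa [← this]

theorem cn_inj (x y : Bool) (A B : Finset ℕ) (h : cn x A = cn y B) : x = y ∧ A = B := by
  constructor
  · have := zero_mem_cn x A
    rw [h, zero_mem_cn] at this
    cases x <;> cases y <;> simp_all
  · ext i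
    rw [← succ_mem_cn x A, h, succ_mem_cn]

theorem sum_pow_cn (n : ℕ) (f : Finset ℕ → ℚ) :
    ∑ A ∈ (Finset.range (n+1)).powerset, f A
      = ∑ x : Bool, ∑ A ∈ (Finset.range n).powerset, f (cn x A) := by
  rw [← Finset.sum_product']
  symm
  refine Finset.sum_bij (fun p _ => cn p.1 p.2) ?_ ?_ ?_ ?_
  · rintro ⟨x, A⟩ h
    simp only [Finset.mem_product, Finset.mem_univ, Finset.mem_powerset, true_and] at *
    intro i
    revert i
    rw [forall_cn]
    refine ⟨by simp, fun i hi => ?_⟩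
    have := h hi
    simp at *; omega
  · rintro ⟨x, A⟩ _ ⟨y, B⟩ _ h
    obtain ⟨h1, h2⟩ := cn_inj _ _ _ _ h
    exact Prod.ext h1 h2
  · intro A hA
    refine ⟨(decide (0 ∈ A), (A.erase 0).image Nat.pred), ?_, (cn_surj A).symm⟩
    simp only [Finset.mem_product, Finset.mem_univ, Finset.mem_powerset, true_and] at *
    intro i hi
    simp only [Finset.mem_image, Finset.mem_erase] at hi
    obtain ⟨j, ⟨h1, h2⟩, h3⟩ := hi
    have := hA h2
    rw [Nat.pred_eq_sub_one] at h3
    simp at *; omega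
  · intros; rfl

theorem modifyIdx_cons (b : ℕ) (d : List ℕ) (x y : Bool) (A B : Finset ℕ) :
    modifyIdx (b :: d) (cn x A) (cn y B) =
      if x then modifyIdx d A B else (b - y.toNat) :: modifyIdx d A B := by
  unfold modifyIdx
  rw [List.length_cons, List.range_succ_eq_map, List.filter_cons, List.filter_map]
  have h1 : (fun i => decide (i ∉ cn x A)) ∘ Nat.succ = fun i => decide (i ∉ A) := by
    funext i
    simp [succ_mem_cn]
  have h2 : (fun i => (b :: d).getD i 0 - if i ∈ cn y B then 1 else 0) ∘ Nat.succ
      = fun i => d.getD i 0 - if i ∈ B then 1 else 0 := by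
    funext i
    simp [succ_mem_cn]
  have h3 : (b :: d).getD 0 0 - (if 0 ∈ cn y B then 1 else 0) = b - y.toNat := by
    cases y <;> simp [zero_mem_cn]
  rw [h1]
  cases x
  · simp only [zero_mem_cn]
    simp only [Bool.false_eq_true, not_false_eq_true, decide_true, if_true, if_false, List.map_cons,
      List.map_map, h2, h3]
  · simp only [zero_mem_cn]
    simp only [not_true_eq_false, decide_false, Bool.false_eq_true, if_true, if_false,
      List.map_map, h2]

def CO (d : List ℕ) (A B : Finset ℕ) : Prop :=
  (∀ i ∈ A, d.getD i 0 = 1) ∧ (∀ i ∈ B, 2 ≤ d.getD i 0) ∧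
  (∀ i, i % 2 = 0 → (i ∈ A ↔ i + 1 ∈ A) ∧ ¬(i ∈ B ∧ i + 1 ∈ B))

theorem CO_cons (b a : ℕ) (d : List ℕ) (x x' y y' : Bool) (A B : Finset ℕ) :
    CO (b :: a :: d) (cn x (cn x' A)) (cn y (cn y' B)) ↔
      ((x = true → b = 1) ∧ (x' = true → a = 1) ∧ (y = true → 2 ≤ b) ∧ (y' = true → 2 ≤ a) ∧
        x = x' ∧ ¬ (y = true ∧ y' = true)) ∧ CO d A B := by
  unfold CO
  rw [forall_cn, forall_cn, forall_cn, forall_cn]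
  have : (∀ i, i % 2 = 0 → (i ∈ cn x (cn x' A) ↔ i + 1 ∈ cn x (cn x' A)) ∧
      ¬(i ∈ cn y (cn y' B) ∧ i + 1 ∈ cn y (cn y' B))) ↔
      (x = x' ∧ ¬ (y = true ∧ y' = true)) ∧
      (∀ i, i % 2 = 0 → (i ∈ A ↔ i + 1 ∈ A) ∧ ¬(i ∈ B ∧ i + 1 ∈ B)) := by
    constructor
    · intro h
      refine ⟨?_, fun i hi => ?_⟩
      · have := h 0 rfl
        simp only [succ_mem_cn, zero_mem_cn] at this
        refine ⟨?_, this.2⟩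
        have := this.1
        cases x <;> cases x' <;> simp_all
      · have := h (i+2) (by omega)
        simpa only [succ_mem_cn] using this
    · rintro ⟨⟨h1, h2⟩, h3⟩ i hi
      rcases i with _ | _ | i
      · simp only [succ_mem_cn, zero_mem_cn]
        rw [h1]; exact ⟨Iff.rfl, h2⟩
      · omega
      · simp only [succ_mem_cn]
        exact h3 i (by omega)
  rw [this]
  simp only [List.getD_cons_zero, List.getD_cons_succ]
  tauto

noncomputable def SO (N : ℕ) (d : List ℕ) (Φ : List ℕ → ℚ) : ℚ :=
  ∑ A ∈ (Finset.range d.length).powerset, ∑ B ∈ (Finset.range d.length).powerset,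
    if CO d A B then
      (-1 : ℚ) ^ B.card * (1 / (N : ℚ)) ^ (A.card + B.card) * Φ (modifyIdx d A B)
    else 0

theorem sum_bool_out (S T : Finset (Finset ℕ)) (g : Bool → Finset ℕ → Bool → Finset ℕ → ℚ) :
    ∑ x : Bool, ∑ A ∈ S, ∑ y : Bool, ∑ B ∈ T, g x A y B
      = ∑ x : Bool, ∑ y : Bool, ∑ A ∈ S, ∑ B ∈ T, g x A y B := by
  apply Finset.sum_congr rfl; intro x _
  rw [Finset.sum_comm]

theorem SO_aux (S T : Finset (Finset ℕ)) (P : Prop) [Decidable P] (Q : Finset ℕ → Finset ℕ → Prop) (k : ℚ)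
    (F G : Finset ℕ → Finset ℕ → ℚ) (H : ∀ A B, F A B = k * G A B) :
    (∑ A ∈ S, ∑ B ∈ T, if P ∧ Q A B then F A B else 0) =
    if P then ∑ A ∈ S, ∑ B ∈ T, k * (if Q A B then G A B else 0) else 0 := by
  by_cases h : P
  · simp only [h, true_and, if_true]
    apply Finset.sum_congr rfl; intro A _
    apply Finset.sum_congr rfl; intro B _
    rw [H]
    split_ifs <;> simp
  · simp only [h, false_and, if_false, Finset.sum_const_zero]

theorem SO_cons (N : ℕ) (b a : ℕ) (d : List ℕ) (Φ : List ℕ → ℚ) :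
    SO N (b :: a :: d) Φ = ∑ x : Bool, ∑ y : Bool, ∑ x' : Bool, ∑ y' : Bool,
      if ((x = true → b = 1) ∧ (x' = true → a = 1) ∧ (y = true → 2 ≤ b) ∧ (y' = true → 2 ≤ a) ∧
        x = x' ∧ ¬ (y = true ∧ y' = true)) then
        (-1 : ℚ) ^ (y.toNat + y'.toNat) *
          (1 / (N : ℚ)) ^ (x.toNat + x'.toNat + y.toNat + y'.toNat) *
        SO N d (fun l => Φ (if x then (if x' then l else (a - y'.toNat) :: l) else
          (b - y.toNat) :: (if x' then l else (a - y'.toNat) :: l)))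
      else 0 := by
  rw [SO]
  simp only [List.length_cons]
  rw [sum_pow_cn]
  simp only [sum_pow_cn (d.length + 1)]
  rw [sum_bool_out]
  apply Finset.sum_congr rfl; intro x _
  apply Finset.sum_congr rfl; intro y _
  simp only [sum_pow_cn (d.length)]
  rw [sum_bool_out]
  apply Finset.sum_congr rfl; intro x' _
  apply Finset.sum_congr rfl; intro y' _
  simp only [CO_cons, SO, Finset.mul_sum]
  refine SO_aux _ _ _ _ _ _ _ ?_
  intro A B
  simp only [modifyIdx_cons, card_cn]
  ring

theorem SO_one (N : ℕ) (b : ℕ) (Φ : List ℕ → ℚ) :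
    SO N [b] Φ = Φ [b] + (if 2 ≤ b then - (1 / (N : ℚ)) * Φ [b - 1] else 0) := by
  rw [SO]
  simp only [List.length_cons]
  rw [sum_pow_cn]
  simp only [sum_pow_cn (List.length [])]
  have h : ∀ x y : Bool, CO [b] (cn x ∅) (cn y ∅) ↔ (x = false ∧ (y = true → 2 ≤ b)) := by
    intro x y
    unfold CO
    rw [forall_cn, forall_cn]
    constructor
    · rintro ⟨_, h1, h2⟩
      refine ⟨?_, fun h => by simpa using h1.1 h⟩
      have := (h2 0 rfl).1
      simpa [zero_mem_cn, succ_mem_cn] using this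
    · rintro ⟨rfl, h2⟩
      refine ⟨by simp, by simpa using h2, ?_⟩
      intro i hi
      rcases i with _ | i
      · simp [zero_mem_cn, succ_mem_cn]
      · simp [succ_mem_cn]
  simp [h, card_cn, modifyIdx_cons]
  simp [modifyIdx]
  by_cases hb : 2 ≤ b <;> simp [hb]
  ring

theorem SO_KK (N : ℕ) : ∀ (d : List ℕ), d.length % 2 = 1 → (∀ x ∈ d, 0 < x) →
    ∀ Φ, SO N d Φ = KK N d Φ
  | [], h, _ => by simp at h
  | [b], _, _ => by intro Φ; rw [SO_one, KK]
  | b :: a :: cs, h, hp => by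
      intro Φ
      have hb : 0 < b := hp b (by simp)
      have ha : 0 < a := hp a (by simp)
      have ih := SO_KK N cs (by simp at h; omega) (fun x hx => hp x (by simp [hx]))
      rw [SO_cons, KK]
      simp only [ih, Fintype.sum_bool]
      by_cases hb2 : 2 ≤ b
      · have hb1 : b ≠ 1 := by omega
        by_cases ha2 : 2 ≤ a
        · have ha1 : a ≠ 1 := by omega
          simp [ha2, hb2, ha1, hb1]; ring
        · have ha1 : a = 1 := by omega
          subst ha1
          simp [hb2, hb1]; ring
      · have hb1 : b = 1 := by omega
        subst hb1
        by_cases ha2 : 2 ≤ a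
        · have ha1 : a ≠ 1 := by omega
          simp [ha2, ha1]; ring
        · have ha1 : a = 1 := by omega
          subst ha1
          simp; ring

theorem cond_head (a : ℕ) (d : List ℕ) (x y : Bool) (A B : Finset ℕ) :
    ((∀ i ∈ cn x A, (a :: d).getD i 0 = 1) ∧ EvenOddZ (cn x A) ∧
      (∀ i ∈ cn y B, 2 ≤ (a :: d).getD i 0) ∧
      (∀ i, i % 2 = 1 → ¬(i ∈ cn y B ∧ i + 1 ∈ cn y B))) ↔
    (x = false ∧ (y = true → 2 ≤ a)) ∧ CO d A B := by
  have h1 : EvenOddZ (cn x A) ↔ x = false ∧ ∀ i, i % 2 = 0 → (i ∈ A ↔ i + 1 ∈ A) := by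
    unfold EvenOddZ
    rw [forall_cn]
    constructor
    · rintro ⟨h1, h2⟩
      refine ⟨?_, ?_⟩
      · cases x
        · rfl
        · simpa using h1 rfl
      · intro i hi
        constructor
        · intro h
          have := (h2 i h).1 (by omega)
          simpa [succ_mem_cn] using this
        · intro h
          have := ((h2 (i+1) h).2 (by omega)).2
          simpa [succ_mem_cn] using this
    · rintro ⟨rfl, h⟩
      refine ⟨by simp, fun i hi => ⟨fun h1 => ?_, fun h1 => ⟨by omega, ?_⟩⟩⟩
      · rw [succ_mem_cn]; exact (h i (by omega)).1 hi
      · rcases i with _ | i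
        · omega
        · rw [Nat.add_sub_cancel, succ_mem_cn]; exact (h i (by omega)).2 hi
  have h2 : (∀ i, i % 2 = 1 → ¬(i ∈ cn y B ∧ i + 1 ∈ cn y B)) ↔
      ∀ i, i % 2 = 0 → ¬ (i ∈ B ∧ i + 1 ∈ B) := by
    constructor
    · intro h i hi
      have := h (i+1) (by omega)
      simpa only [succ_mem_cn] using this
    · intro h i hi
      rcases i with _ | i
      · omega
      · simpa only [succ_mem_cn] using h i (by omega)
  rw [h1, h2, forall_cn, forall_cn, CO]
  simp only [List.getD_cons_zero, List.getD_cons_succ, imp_and, forall_and]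
  constructor
  · rintro ⟨⟨_, p⟩, ⟨q, r⟩, ⟨s, t⟩, u⟩
    exact ⟨⟨q, s⟩, p, t, r, u⟩
  · rintro ⟨⟨q, s⟩, p, t, r, u⟩
    exact ⟨⟨by simp [q], p⟩, ⟨q, r⟩, ⟨s, t⟩, u⟩

theorem rhs_head (N a : ℕ) (d : List ℕ) (Φ : List ℕ → ℚ) (c : List ℕ) (hc : c = a :: d) :
    (∑ A ∈ (Finset.range c.length).powerset,
        ∑ B ∈ (Finset.range c.length).powerset,
          if (∀ i ∈ A, c.getD i 0 = 1) ∧ EvenOddZ A ∧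
              (∀ i ∈ B, 2 ≤ c.getD i 0) ∧
              (∀ i, i % 2 = 1 → ¬(i ∈ B ∧ i + 1 ∈ B)) then
            (-1 : ℚ) ^ B.card * (1 / (N : ℚ)) ^ (A.card + B.card) *
              Φ (modifyIdx c A B)
          else 0) =
    SO N d (fun l => Φ (a :: l)) +
      (if 2 ≤ a then - (1 / (N : ℚ)) * SO N d (fun l => Φ ((a - 1) :: l)) else 0) := by
  subst hc
  rw [List.length_cons, sum_pow_cn]
  simp only [sum_pow_cn]
  rw [sum_bool_out]
  simp only [cond_head, modifyIdx_cons, card_cn]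
  have key : ∀ x y : Bool, (∑ A ∈ (Finset.range d.length).powerset,
      ∑ B ∈ (Finset.range d.length).powerset,
      if (x = false ∧ (y = true → 2 ≤ a)) ∧ CO d A B then
        (-1 : ℚ) ^ (B.card + y.toNat) *
          (1 / (N : ℚ)) ^ (A.card + x.toNat + (B.card + y.toNat)) *
          Φ (if x = true then modifyIdx d A B else (a - y.toNat) :: modifyIdx d A B)
      else 0) =
      if (x = false ∧ (y = true → 2 ≤ a)) then
        ((-1 : ℚ) ^ y.toNat * (1 / (N : ℚ)) ^ (x.toNat + y.toNat)) *
          SO N d (fun l => Φ (if x = true then l else (a - y.toNat) :: l))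
      else 0 := by
    intro x y
    simp only [SO, Finset.mul_sum]
    refine SO_aux _ _ _ _ _ _ _ ?_
    intro A B
    ring
  simp only [key, Fintype.sum_bool]
  by_cases h : 2 ≤ a
  · simp [h]; ring
  · simp [h]

/-! ### The diamond sum satisfies the recursion -/

def cF {n : ℕ} (x : Bool) (A : Finset (Fin n)) : Finset (Fin (n+1)) :=
  if x then insert 0 (A.map (Fin.succEmb n)) else A.map (Fin.succEmb n)

theorem zero_mem_cF {n : ℕ} (x : Bool) (A : Finset (Fin n)) : 0 ∈ cF x A ↔ x = true := by
  cases x <;> simp [cF, Fin.succ_ne_zero]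

theorem succ_mem_cF {n : ℕ} (x : Bool) (A : Finset (Fin n)) (i : Fin n) :
    i.succ ∈ cF x A ↔ i ∈ A := by
  cases x <;> simp [cF, Fin.succ_ne_zero]

theorem card_cF {n : ℕ} (x : Bool) (A : Finset (Fin n)) :
    (cF x A).card = A.card + x.toNat := by
  cases x
  · simp [cF]
  · simp only [cF, if_true]
    rw [Finset.card_insert_of_notMem (by simp [Fin.succ_ne_zero])]
    simp

theorem forall_cF {n : ℕ} (x : Bool) (A : Finset (Fin n)) (P : Fin (n+1) → Prop) :
    (∀ i ∈ cF x A, P i) ↔ (x = true → P 0) ∧ ∀ i ∈ A, P i.succ := by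
  constructor
  · intro h
    exact ⟨fun hx => h 0 ((zero_mem_cF x A).2 hx), fun i hi => h _ ((succ_mem_cF x A i).2 hi)⟩
  · rintro ⟨h0, h1⟩ i
    refine Fin.cases ?_ ?_ i
    · exact fun hi => h0 ((zero_mem_cF x A).1 hi)
    · exact fun i hi => h1 i ((succ_mem_cF x A i).1 hi)

theorem sum_cF (n : ℕ) (f : Finset (Fin (n+1)) → ℚ) :
    ∑ A : Finset (Fin (n+1)), f A = ∑ x : Bool, ∑ A : Finset (Fin n), f (cF x A) := by
  rw [← Finset.sum_product']
  symm
  refine Finset.sum_bij (fun p _ => cF p.1 p.2) (by simp) ?_ ?_ ?_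
  · rintro ⟨x, A⟩ _ ⟨y, B⟩ _ h
    simp only at h
    have h0 := zero_mem_cF x A
    rw [h, zero_mem_cF] at h0
    refine Prod.ext ?_ ?_
    · cases x <;> cases y <;> simp_all
    · ext i
      simp only
      rw [← succ_mem_cF x A, h, succ_mem_cF]
  · intro A _
    refine ⟨(decide (0 ∈ A), Finset.univ.filter (fun i => i.succ ∈ A)),
      Finset.mem_product.2 ⟨Finset.mem_univ _, Finset.mem_univ _⟩, ?_⟩
    ext i
    refine Fin.cases ?_ ?_ i
    · simp [zero_mem_cF]
    · intro i; simp [succ_mem_cF]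
  · intros; rfl

theorem sum_cons_pi {n : ℕ} (α : Fin (n+1) → Type) [∀ i, Fintype (α i)]
    (f : (∀ i, α i) → ℚ) :
    ∑ m : (∀ i, α i), f m = ∑ v : α 0, ∑ m : (∀ i : Fin n, α i.succ), f (Fin.cons v m) := by
  rw [← Finset.sum_product']
  symm
  exact Fintype.sum_equiv (Fin.consEquiv α) (fun p => f (Fin.cons p.1 p.2)) f (fun _ => rfl)

def zC (M p : ℕ) (k : List ℕ) (A : Finset (Fin k.length)) (n : Fin k.length → Fin M) : Prop :=
  (∀ i ∈ A, k.get i = 1) ∧ (∀ h : 0 < k.length, p < (n ⟨0, h⟩ : ℕ)) ∧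
    ∀ (i : Fin k.length) (h : (i : ℕ) + 1 < k.length),
      if i ∈ A then n i ≤ n ⟨(i : ℕ) + 1, h⟩ else n i < n ⟨(i : ℕ) + 1, h⟩

noncomputable def zG (M p : ℕ) (k : List ℕ) : ℚ :=
  ∑ A : Finset (Fin k.length), ∑ n : Fin k.length → Fin M,
    if zC M p k A n then
      ∏ i : Fin k.length,
          if i ∈ A then (1 : ℚ) / ((M : ℚ) - ((n i : ℕ) : ℚ))
          else (1 : ℚ) / (((n i : ℕ) : ℚ) ^ k.get i)
    else 0

theorem zC_zero (M : ℕ) (k : List ℕ) (A : Finset (Fin k.length)) (n : Fin k.length → Fin M) :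
    zC M 0 k A n ↔ (∀ i ∈ A, k.get i = 1) ∧ (∀ i, 0 < (n i : ℕ)) ∧
    ∀ (i : Fin k.length) (h : (i : ℕ) + 1 < k.length),
      if i ∈ A then n i ≤ n ⟨(i : ℕ) + 1, h⟩ else n i < n ⟨(i : ℕ) + 1, h⟩ := by
  unfold zC
  constructor
  · rintro ⟨h1, h2, h3⟩
    refine ⟨h1, ?_, h3⟩
    rintro ⟨i, hi⟩
    induction i with
    | zero => exact h2 hi
    | succ i ih =>
      have := ih (by omega)
      have h4 := h3 ⟨i, by omega⟩ hi
      split_ifs at h4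
      · exact lt_of_lt_of_le this h4
      · exact lt_trans this h4
  · rintro ⟨h1, h2, h3⟩
    exact ⟨h1, fun h => h2 _, h3⟩

theorem zdiaL_eq (M : ℕ) (k : List ℕ) : zdiaL M k = zG M 0 k := by
  unfold zdiaL zG
  apply Finset.sum_congr rfl
  intro A _
  simp only [zC_zero]
  by_cases h : ∀ i ∈ A, k.get i = 1
  · rw [if_pos h, Finset.sum_filter]
    apply Finset.sum_congr rfl
    intro n _
    apply if_congr _ rfl rfl
    exact ⟨fun h' => ⟨h, h'⟩, fun h' => h'.2⟩
  · rw [if_neg h, Finset.sum_eq_zero]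
    intro n _
    rw [if_neg (fun h' => h h'.1)]

theorem zC_cons (M p a : ℕ) (ks : List ℕ) (x : Bool) (A : Finset (Fin ks.length)) (v : Fin M)
    (n : Fin ks.length → Fin M) :
    zC M p (a :: ks) (cF x A) (Fin.cons v n : Fin (ks.length + 1) → Fin M) ↔
      ((x = true → a = 1) ∧ p < (v : ℕ)) ∧
      zC M (if x = true then (v : ℕ) - 1 else (v : ℕ)) ks A n := by
  unfold zC
  have h1 := forall_cF x A (fun i => (a :: ks).get i = 1)
  constructor
  · rintro ⟨H1, H2, H3⟩
    have H2' : p < (v : ℕ) := H2 (Nat.succ_pos _)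
    refine ⟨⟨(h1.1 H1).1, H2'⟩, (h1.1 H1).2, ?_, ?_⟩
    · intro h
      have := H3 (0 : Fin (ks.length + 1)) (by simpa using h)
      have e : (Fin.cons v n : Fin (ks.length + 1) → Fin M)
        ⟨((0 : Fin (ks.length + 1)) : ℕ) + 1, by simpa using h⟩ = n ⟨0, h⟩ := rfl
      have e0 : (Fin.cons v n : Fin (ks.length + 1) → Fin M) 0 = v := rfl
      erw [e, e0] at this
      have hm := zero_mem_cF x A
      cases x
      · rw [if_neg (by rw [hm]; simp)] at this
        simpa using this
      · rw [if_pos (by rw [hm])] at this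
        have : (v : ℕ) ≤ (n ⟨0, h⟩ : ℕ) := this
        simp; omega
    · intro i h
      have := H3 i.succ (by simpa using h)
      have e : (Fin.cons v n : Fin (ks.length + 1) → Fin M)
        ⟨((i.succ : Fin (ks.length + 1)) : ℕ) + 1, by simpa using h⟩ = n ⟨(i : ℕ) + 1, h⟩ := rfl
      have e0 : (Fin.cons v n : Fin (ks.length + 1) → Fin M) i.succ = n i := rfl
      erw [e, e0] at this
      simp only [succ_mem_cF] at this
      exact this
  · rintro ⟨⟨H1, H2⟩, H3, H4, H5⟩
    refine ⟨h1.2 ⟨H1, H3⟩, fun _ => H2, ?_⟩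
    intro i
    refine Fin.cases ?_ ?_ i
    · intro h
      have h' : 0 < ks.length := by simpa using h
      have := H4 h'
      change if (0 : Fin (ks.length + 1)) ∈ cF x A then v ≤ n ⟨0, h'⟩ else v < n ⟨0, h'⟩
      simp only [zero_mem_cF]
      cases x
      · simpa using this
      · simp at this ⊢
        change (v : ℕ) ≤ (n ⟨0, h'⟩ : ℕ)
        omega
    · intro i h
      have h' : (i : ℕ) + 1 < ks.length := by simpa using h
      have := H5 i h'
      change if i.succ ∈ cF x A then n i ≤ n ⟨(i : ℕ) + 1, h'⟩ else n i < n ⟨(i : ℕ) + 1, h'⟩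
      simp only [succ_mem_cF]
      exact this

theorem zG_cons (M p a : ℕ) (ks : List ℕ) :
    zG M p (a :: ks) = ∑ x : Bool, ∑ v : Fin M,
      if ((x = true → a = 1) ∧ p < (v : ℕ)) then
        (if x = true then (1 : ℚ) / ((M : ℚ) - ((v : ℕ) : ℚ))
          else (1 : ℚ) / (((v : ℕ) : ℚ) ^ a)) *
        zG M (if x = true then (v : ℕ) - 1 else (v : ℕ)) ks
      else 0 := by
  rw [zG]
  change ∑ A : Finset (Fin (ks.length + 1)), _ = _
  rw [sum_cF]
  apply Finset.sum_congr rfl; intro x _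
  have : ∀ A : Finset (Fin ks.length), (∑ n : Fin (a :: ks).length → Fin M,
    if zC M p (a :: ks) (cF x A) n then
      ∏ i : Fin (a :: ks).length,
          if i ∈ (cF x A : Finset (Fin (a :: ks).length)) then
            (1 : ℚ) / ((M : ℚ) - ((n i : ℕ) : ℚ))
          else (1 : ℚ) / (((n i : ℕ) : ℚ) ^ (a :: ks).get i)
    else 0) = ∑ v : Fin M, ∑ n : Fin ks.length → Fin M,
      if ((x = true → a = 1) ∧ p < (v : ℕ)) then
        (if x = true then (1 : ℚ) / ((M : ℚ) - ((v : ℕ) : ℚ))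
          else (1 : ℚ) / (((v : ℕ) : ℚ) ^ a)) *
        (if zC M (if x = true then (v : ℕ) - 1 else (v : ℕ)) ks A n then
          ∏ i : Fin ks.length,
          if i ∈ A then (1 : ℚ) / ((M : ℚ) - ((n i : ℕ) : ℚ))
          else (1 : ℚ) / (((n i : ℕ) : ℚ) ^ ks.get i)
        else 0) else 0 := by
    intro A
    refine (sum_cons_pi (n := ks.length) (fun _ => Fin M) _).trans ?_
    apply Finset.sum_congr rfl; intro v _
    apply Finset.sum_congr rfl; intro n _
    simp only [zC_cons, ite_and (P := (_ ∧ _))]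
    apply if_congr Iff.rfl _ rfl
    rw [mul_ite, mul_zero]
    apply if_congr Iff.rfl _ rfl
    refine (Fin.prod_univ_succ (n := ks.length) _).trans ?_
    congr 1
    · change (if (0 : Fin (ks.length + 1)) ∈ cF x A then (1 : ℚ) / ((M : ℚ) - ((v : ℕ) : ℚ))
        else (1 : ℚ) / (((v : ℕ) : ℚ) ^ a)) = _
      simp only [zero_mem_cF]
    · apply Finset.prod_congr rfl; intro i _
      change (if i.succ ∈ cF x A then (1 : ℚ) / ((M : ℚ) - ((n i : ℕ) : ℚ))
        else (1 : ℚ) / (((n i : ℕ) : ℚ) ^ ks.get i)) = _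
      simp only [succ_mem_cF]
  refine (Finset.sum_congr rfl (fun A _ => this A)).trans ?_
  rw [Finset.sum_comm]
  apply Finset.sum_congr rfl; intro v _
  split_ifs with h <;> simp only [zG, Finset.mul_sum, Finset.sum_const_zero]

theorem zG_ZZ (N : ℕ) : ∀ (k : List ℕ) (p : ℕ), zG (N+1) p k = ZZ N k p
  | [], p => by
      simp [zG, ZZ, zC]
  | a :: ks, p => by
      have key : ∀ (f : ℕ → ℚ) (P : Prop) [Decidable P],
          (∑ v : Fin (N+1), if (P ∧ p < (v : ℕ)) then f v else 0)
          = ∑ v ∈ Finset.Ioc p N, if P then f v else 0 := by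
        intro f P _
        rw [Fin.sum_univ_eq_sum_range (fun v => if (P ∧ p < v) then f v else 0) (N+1)]
        have : Finset.Ioc p N = (Finset.range (N+1)).filter (fun v => p < v) := by
          ext; simp; omega
        rw [this, Finset.sum_filter]
        apply Finset.sum_congr rfl; intro v _
        by_cases h1 : P <;> by_cases h2 : p < v <;> simp [h1, h2]
      rw [zG_cons, ZZ, Fintype.sum_bool]
      simp only [zG_ZZ N ks]
      refine (congrArg₂ (· + ·)
        (@key (fun v => (if True then (1 : ℚ) / (((N + 1 : ℕ) : ℚ) - (v : ℚ))
          else (1 : ℚ) / ((v : ℚ) ^ a)) * ZZ N ks (if True then v - 1 else v)) (True → a = 1) _)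
        (@key (fun v => (if false = true then (1 : ℚ) / (((N + 1 : ℕ) : ℚ) - (v : ℚ))
          else (1 : ℚ) / ((v : ℚ) ^ a)) * ZZ N ks (if false = true then v - 1 else v))
          (false = true → a = 1) _)).trans ?_
      rw [← Finset.sum_add_distrib]
      apply Finset.sum_congr rfl; intro v _
      simp

/-! ### The sum `hN` through operators -/

def hL (N p : ℕ) (c : List ℕ) (A : Finset (Fin c.length))
    (n : ∀ i : Fin c.length, Fin (c.get i) → Fin N) (j : Fin c.length) (b : Fin (c.get j)) : Prop :=
  if (j : ℕ) = 0 then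
    (if j ∈ A then (n j b : ℕ) = p else p < (n j b : ℕ))
  else
    ∀ (j' : Fin c.length) (a : Fin (c.get j')),
      (j' : ℕ) + 1 = (j : ℕ) → (a : ℕ) + 1 = c.get j' →
      (if j ∈ A then (n j' a : ℕ) = (n j b : ℕ)
        else (n j' a : ℕ) < (n j b : ℕ))

def hC (N p : ℕ) (c : List ℕ) (A : Finset (Fin c.length))
    (n : ∀ i : Fin c.length, Fin (c.get i) → Fin N) : Prop :=
  (∀ i ∈ A, c.get i = 1) ∧ (∀ i, Monotone (n i)) ∧
    (∀ (j : Fin c.length) (b : Fin (c.get j)), (b : ℕ) = 0 → hL N p c A n j b)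

/-- The weight of a block of parity `par`. -/
def wB (N par n : ℕ) : ℚ :=
  if par % 2 = 0 then (1 : ℚ) / ((N : ℚ) - (n : ℚ)) else (1 : ℚ) / (n : ℚ)

noncomputable def hG (N par p : ℕ) (c : List ℕ) : ℚ :=
  ∑ A : Finset (Fin c.length), ∑ n : (∀ i : Fin c.length, Fin (c.get i) → Fin N),
    if hC N p c A n then
      (1 / (N : ℚ)) ^ A.card * ∏ i : Fin c.length, ∏ j : Fin (c.get i),
          if i ∈ A then 1 else wB N ((i : ℕ) + par) (n i j)
    else 0

theorem hN_eq_hG (N : ℕ) (c : List ℕ) : hN N c = hG N 0 0 c := by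
  unfold hN hG
  apply Finset.sum_congr rfl
  intro A _
  by_cases h : ∀ i ∈ A, c.get i = 1
  · rw [if_pos h, Finset.sum_filter, Finset.mul_sum]
    apply Finset.sum_congr rfl
    intro n _
    rw [mul_ite, mul_zero]
    refine if_congr ?_ rfl rfl
    exact ⟨fun h' => ⟨h, h'⟩, fun h' => h'.2⟩
  · rw [if_neg h, Finset.sum_eq_zero]
    intro n _
    rw [if_neg (fun h' => h h'.1)]

theorem hL_zero (N p a : ℕ) (cs : List ℕ) (x : Bool) (A : Finset (Fin cs.length))
    (ν : Fin (a + 1) → Fin N) (n : ∀ i : Fin cs.length, Fin (cs.get i) → Fin N)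
    (b : Fin (a + 1)) :
    hL N p ((a + 1) :: cs) (cF x A)
      (Fin.cons (α := fun i : Fin (cs.length + 1) => Fin (((a + 1) :: cs).get i) → Fin N) ν n)
      (0 : Fin (cs.length + 1)) b ↔
      (if x = true then (ν b : ℕ) = p else p < (ν b : ℕ)) := by
  unfold hL
  refine (Iff.of_eq (if_pos rfl)).trans ?_
  change (if (0 : Fin (cs.length + 1)) ∈ cF x A then (ν b : ℕ) = p else p < (ν b : ℕ)) ↔ _
  simp only [zero_mem_cF]

theorem hL_succ (N p a : ℕ) (cs : List ℕ) (x : Bool) (A : Finset (Fin cs.length))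
    (ν : Fin (a + 1) → Fin N) (n : ∀ i : Fin cs.length, Fin (cs.get i) → Fin N)
    (j : Fin cs.length) (b : Fin (cs.get j)) :
    hL N p ((a + 1) :: cs) (cF x A)
      (Fin.cons (α := fun i : Fin (cs.length + 1) => Fin (((a + 1) :: cs).get i) → Fin N) ν n)
      (j.succ : Fin (cs.length + 1)) b ↔
      hL N (ν (Fin.last a)) cs A n j b := by
  unfold hL
  rw [if_neg (by simp : ¬ ((j.succ : Fin (cs.length + 1)) : ℕ) = 0)]
  have key : ∀ (P Q : Prop), (if (j.succ : Fin (cs.length + 1)) ∈ cF x A then P else Q) ↔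
      if j ∈ A then P else Q := by
    intro P Q; simp only [succ_mem_cF]
  constructor
  · intro H
    by_cases hj : (j : ℕ) = 0
    · rw [if_pos hj]
      have h := (key _ _).1 (H (0 : Fin (cs.length + 1)) (Fin.last a) (by simp [hj]) (by simp))
      change if j ∈ A then (ν (Fin.last a) : ℕ) = (n j b : ℕ)
        else (ν (Fin.last a) : ℕ) < (n j b : ℕ) at h
      split_ifs at h ⊢ with h1
      · exact h.symm
      · exact h
    · rw [if_neg hj]
      intro j' a' h1 h2
      exact (key _ _).1 (H (j'.succ : Fin (cs.length + 1)) a' (by simp [h1]) (by simpa using h2))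
  · intro H j'
    refine Fin.cases ?_ ?_ j'
    · intro a' h1 h2
      have hj : (j : ℕ) = 0 := by
        have : 0 + 1 = (j : ℕ) + 1 := h1
        omega
      rw [if_pos hj] at H
      have ha : a' = Fin.last a := by
        apply Fin.ext
        have : (a' : ℕ) + 1 = a + 1 := h2
        simpa using this
      subst ha
      refine (key _ _).2 ?_
      change if j ∈ A then (ν (Fin.last a) : ℕ) = (n j b : ℕ)
        else (ν (Fin.last a) : ℕ) < (n j b : ℕ)
      split_ifs at H ⊢ with h1
      · exact H.symm
      · exact H
    · intro j' a' h1 h2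
      have h1' : (j' : ℕ) + 1 = (j : ℕ) := by
        have : (j' : ℕ) + 1 + 1 = (j : ℕ) + 1 := h1
        omega
      rw [if_neg (by omega)] at H
      exact (key _ _).2 (H j' a' h1' h2)

theorem hC_cons (N p a : ℕ) (cs : List ℕ) (x : Bool) (A : Finset (Fin cs.length))
    (ν : Fin (a + 1) → Fin N) (n : ∀ i : Fin cs.length, Fin (cs.get i) → Fin N) :
    hC N p ((a + 1) :: cs) (cF x A)
      (Fin.cons (α := fun i : Fin (cs.length + 1) => Fin (((a + 1) :: cs).get i) → Fin N) ν n) ↔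
      ((x = true → a + 1 = 1) ∧ Monotone ν ∧
        (if x = true then (ν 0 : ℕ) = p else p < (ν 0 : ℕ))) ∧
      hC N (ν (Fin.last a)) cs A n := by
  unfold hC
  have h1 := forall_cF x A (fun i => ((a + 1) :: cs).get i = 1)
  constructor
  · rintro ⟨H1, H2, H3⟩
    refine ⟨⟨(h1.1 H1).1, H2 (0 : Fin (cs.length + 1)), ?_⟩, (h1.1 H1).2,
      fun i => H2 (i.succ : Fin (cs.length + 1)), ?_⟩
    · exact (hL_zero N p a cs x A ν n 0).1 (H3 (0 : Fin (cs.length + 1)) (0 : Fin (a + 1)) rfl)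
    · intro j b hb
      exact (hL_succ N p a cs x A ν n j b).1 (H3 (j.succ : Fin (cs.length + 1)) b hb)
  · rintro ⟨⟨H1, H2, H3⟩, H4, H5, H6⟩
    refine ⟨h1.2 ⟨H1, H4⟩, fun i => ?_, fun j => ?_⟩
    · refine Fin.cases ?_ ?_ i
      · exact H2
      · exact H5
    · refine Fin.cases ?_ ?_ j
      · intro b hb
        have : b = (0 : Fin (a + 1)) := Fin.ext hb
        subst this
        exact (hL_zero N p a cs x A ν n 0).2 H3
      · intro j b hb
        exact (hL_succ N p a cs x A ν n j b).2 (H6 j b hb)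

theorem hG_cons (N par p a : ℕ) (cs : List ℕ) :
    hG N par p ((a + 1) :: cs) = ∑ x : Bool, ∑ ν : Fin (a + 1) → Fin N,
      if ((x = true → a + 1 = 1) ∧ Monotone ν ∧
        (if x = true then (ν 0 : ℕ) = p else p < (ν 0 : ℕ))) then
        ((1 / (N : ℚ)) ^ x.toNat * ∏ j : Fin (a + 1), if x = true then 1 else wB N par (ν j)) *
        hG N (par + 1) (ν (Fin.last a)) cs
      else 0 := by
  rw [hG]
  change ∑ A : Finset (Fin (cs.length + 1)), _ = _
  rw [sum_cF]
  apply Finset.sum_congr rfl; intro x _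
  have : ∀ A : Finset (Fin cs.length),
    (∑ n : (∀ i : Fin ((a + 1) :: cs).length, Fin (((a + 1) :: cs).get i) → Fin N),
    if hC N p ((a + 1) :: cs) (cF x A) n then
      (1 / (N : ℚ)) ^ (cF x A).card *
      ∏ i : Fin ((a + 1) :: cs).length, ∏ j : Fin (((a + 1) :: cs).get i),
          if i ∈ (cF x A : Finset (Fin ((a + 1) :: cs).length)) then 1
          else wB N ((i : ℕ) + par) (n i j)
    else 0) = ∑ ν : Fin (a + 1) → Fin N, ∑ n : (∀ i : Fin cs.length, Fin (cs.get i) → Fin N),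
      if ((x = true → a + 1 = 1) ∧ Monotone ν ∧
        (if x = true then (ν 0 : ℕ) = p else p < (ν 0 : ℕ))) then
        ((1 / (N : ℚ)) ^ x.toNat * ∏ j : Fin (a + 1), if x = true then 1 else wB N par (ν j)) *
        (if hC N (ν (Fin.last a)) cs A n then
          (1 / (N : ℚ)) ^ A.card * ∏ i : Fin cs.length, ∏ j : Fin (cs.get i),
          if i ∈ A then 1 else wB N ((i : ℕ) + (par + 1)) (n i j)
        else 0) else 0 := by
    intro A
    refine (sum_cons_pi (n := cs.length)
      (fun i : Fin (cs.length + 1) => Fin (((a + 1) :: cs).get i) → Fin N) _).trans ?_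
    apply Finset.sum_congr rfl; intro (ν : Fin (a + 1) → Fin N) _
    apply Finset.sum_congr rfl; intro n _
    have hc := hC_cons N p a cs x A ν n
    by_cases h1 : ((x = true → a + 1 = 1) ∧ Monotone ν ∧
        (if x = true then (ν 0 : ℕ) = p else p < (ν 0 : ℕ)))
    swap
    · rw [if_neg h1]
      exact if_neg (fun h => h1 (hc.1 h).1)
    rw [if_pos h1]
    by_cases h2 : hC N (ν (Fin.last a)) cs A n
    swap
    · rw [if_neg h2, mul_zero]
      exact if_neg (fun h => h2 (hc.1 h).2)
    rw [if_pos h2]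
    refine (if_pos (hc.2 ⟨h1, h2⟩)).trans ?_
    rw [card_cF, pow_add]
    have e := Fin.prod_univ_succ (n := cs.length) (fun i : Fin (cs.length + 1) =>
      ∏ j : Fin (((a + 1) :: cs).get i),
          if i ∈ (cF x A : Finset (Fin (cs.length + 1))) then (1 : ℚ)
          else wB N ((i : ℕ) + par)
          ((Fin.cons (α := fun i : Fin (cs.length + 1) => Fin (((a + 1) :: cs).get i) → Fin N) ν n
            : ∀ i : Fin (cs.length + 1), Fin (((a + 1) :: cs).get i) → Fin N) i j))
    refine (congrArg (fun t => _ * t) e).trans ?_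
    have e0 : (∏ j : Fin (a + 1),
          if (0 : Fin (cs.length + 1)) ∈ (cF x A : Finset (Fin (cs.length + 1))) then (1 : ℚ)
          else wB N (0 + par) (ν j)) = ∏ j : Fin (a + 1), if x = true then 1 else wB N par (ν j) := by
      simp only [zero_mem_cF, zero_add]
    have e1 : (∏ i : Fin cs.length, ∏ j : Fin (cs.get i),
          if i.succ ∈ (cF x A : Finset (Fin (cs.length + 1))) then (1 : ℚ)
          else wB N (((i : ℕ) + 1) + par) (n i j)) = ∏ i : Fin cs.length, ∏ j : Fin (cs.get i),
          if i ∈ A then 1 else wB N ((i : ℕ) + (par + 1)) (n i j) := by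
      simp only [succ_mem_cF]
      simp only [add_assoc, add_comm 1 par]
    rw [← e0, ← e1]
    have er : ∀ u v X Y : ℚ, u * v * (X * Y) = v * X * (u * Y) := by intros; ring
    exact er _ _ _ _
  refine (Finset.sum_congr rfl (fun A _ => this A)).trans ?_
  rw [Finset.sum_comm]
  apply Finset.sum_congr rfl; intro ν _
  split_ifs with h <;> simp only [hG, Finset.mul_sum, Finset.sum_const_zero]

/-! ### Block sums -/

noncomputable def BS (N : ℕ) (w φ : ℕ → ℚ) (j r : ℕ) : ℚ :=
  ∑ ν : Fin (j + 1) → Fin N,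
    if Monotone ν ∧ r ≤ (ν 0 : ℕ) then (∏ i, w (ν i)) * φ (ν (Fin.last j)) else 0

theorem sum_fin_ge (N r : ℕ) (f : ℕ → ℚ) :
    (∑ v : Fin N, if r ≤ (v : ℕ) then f v else 0) = ∑ v ∈ Finset.Ico r N, f v := by
  rw [Fin.sum_univ_eq_sum_range (fun v => if r ≤ v then f v else 0) N]
  have : Finset.Ico r N = (Finset.range N).filter (fun v => r ≤ v) := by
    ext; simp; omega
  rw [this, Finset.sum_filter]

theorem BS_zero (N : ℕ) (w φ : ℕ → ℚ) (r : ℕ) :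
    BS N w φ 0 r = ∑ n ∈ Finset.Ico r N, w n * φ n := by
  rw [← sum_fin_ge, BS]
  refine Fintype.sum_equiv (Equiv.funUnique (Fin 1) (Fin N)) _ _ ?_
  intro ν
  have hm : Monotone ν := fun a b _ => by rw [Subsingleton.elim a b]
  simp [hm]

theorem BS_succ (N : ℕ) (w φ : ℕ → ℚ) (j r : ℕ) :
    BS N w φ (j + 1) r = ∑ n ∈ Finset.Ico r N, w n * BS N w φ j n := by
  rw [← sum_fin_ge, BS]
  refine (sum_cons_pi (n := j + 1) (fun _ => Fin N) _).trans ?_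
  apply Finset.sum_congr rfl; intro v _
  have key : ∀ ν : Fin (j + 1) → Fin N, (if Monotone (Fin.cons v ν : Fin (j + 2) → Fin N) ∧
      r ≤ (((Fin.cons v ν : Fin (j + 2) → Fin N) 0 : Fin N) : ℕ) then
      (∏ i, w ((Fin.cons v ν : Fin (j + 2) → Fin N) i)) *
        φ ((Fin.cons v ν : Fin (j + 2) → Fin N) (Fin.last (j + 1))) else 0) =
      if r ≤ (v : ℕ) then w v * (if Monotone ν ∧ (v : ℕ) ≤ (ν 0 : ℕ) then
        (∏ i, w (ν i)) * φ (ν (Fin.last j)) else 0) else 0 := by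
    intro ν
    have hm : Monotone (Fin.cons v ν : Fin (j + 2) → Fin N) ↔ v ≤ ν 0 ∧ Monotone ν :=
      monotone_vecCons
    have hv : v ≤ ν 0 ↔ (v : ℕ) ≤ (ν 0 : ℕ) := Iff.rfl
    rw [Fin.prod_univ_succ]
    have e : (Fin.cons v ν : Fin (j + 2) → Fin N) (Fin.last (j + 1)) = ν (Fin.last j) := rfl
    simp only [Fin.cons_zero, Fin.cons_succ, e]
    by_cases h1 : r ≤ (v : ℕ) <;> by_cases h2 : Monotone ν <;>
      by_cases h3 : (v : ℕ) ≤ (ν 0 : ℕ) <;> simp [hm, hv, h1, h2, h3, mul_assoc]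
  refine (Finset.sum_congr rfl (fun ν _ => key ν)).trans ?_
  split_ifs with h
  · rw [BS, Finset.mul_sum]
  · simp

theorem BS_eq (N : ℕ) (w w' φ ξ : ℕ → ℚ) (hw : ∀ n, 1 ≤ n → n < N → w n = w' n)
    (hφ : ∀ n, n < N → φ n = ∑ m ∈ Finset.Ioc n N, ξ m) : ∀ (j r : ℕ), 1 ≤ r →
    BS N w φ j r = ∑ m ∈ Finset.Icc r N, ((opA N w' ^ j) (opS N w' ξ)) m := by
  have hz : ∀ j, ((opA N w' ^ j) (opS N w' ξ)) N = 0 := by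
    intro j
    induction j with
    | zero => simp [opS_apply]
    | succ j ih => rw [pow_succ', Module.End.mul_apply, opA_apply]; simp [ih]
  have hI : ∀ j r, ∑ m ∈ Finset.Icc r N, ((opA N w' ^ j) (opS N w' ξ)) m =
      ∑ m ∈ Finset.Ico r N, ((opA N w' ^ j) (opS N w' ξ)) m := by
    intro j r
    symm
    apply Finset.sum_subset
    · intro x; simp only [Finset.mem_Ico, Finset.mem_Icc]; omega
    · intro x h1 h2
      have : x = N := by simp only [Finset.mem_Ico, Finset.mem_Icc] at h1 h2; omega
      rw [this, hz]
  intro j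
  induction j with
  | zero =>
    intro r hr
    rw [hI, BS_zero]
    apply Finset.sum_congr rfl; intro n hn
    rw [Finset.mem_Ico] at hn
    rw [hw n (by omega) hn.2, hφ n hn.2]
    rfl
  | succ j ih =>
    intro r hr
    rw [hI, BS_succ]
    apply Finset.sum_congr rfl; intro n hn
    rw [Finset.mem_Ico] at hn
    rw [hw n (by omega) hn.2, ih n (by omega), pow_succ', Module.End.mul_apply, opA_apply]

theorem hG_cons' (N par p a : ℕ) (hp : p < N) (cs : List ℕ) :
    hG N par p ((a + 1) :: cs) =
      (if a + 1 = 1 then (1 / (N : ℚ)) * hG N (par + 1) p cs else 0) +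
      BS N (wB N par) (fun n => hG N (par + 1) n cs) a (p + 1) := by
  rw [hG_cons, Fintype.sum_bool]
  congr 1
  · by_cases ha : a + 1 = 1
    · rw [if_pos ha]
      have ha0 : a = 0 := by omega
      subst ha0
      rw [Finset.sum_eq_single (fun _ => (⟨p, hp⟩ : Fin N))]
      · rw [if_pos ⟨fun _ => rfl, fun _ _ _ => le_refl _, by simp⟩]
        simp
      · intro ν _ hν
        apply if_neg
        rintro ⟨_, _, h⟩
        rw [if_pos rfl] at h
        apply hν
        funext i
        rw [show i = 0 from Fin.ext (by omega)]
        exact Fin.ext h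
      · simp
    · rw [if_neg ha]
      apply Finset.sum_eq_zero
      intro ν _
      exact if_neg (fun h => ha (h.1 rfl))
  · rw [BS]
    apply Finset.sum_congr rfl; intro ν _
    by_cases h : Monotone ν ∧ p + 1 ≤ (ν 0 : ℕ)
    · rw [if_pos h, if_pos ⟨by simp, h.1, by simpa using h.2⟩]
      simp
    · rw [if_neg h, if_neg]
      rintro ⟨_, h1, h2⟩
      exact h ⟨h1, by simpa using h2⟩

theorem hG_et (N : ℕ) : ∀ (c : List ℕ), (∀ x ∈ c, 0 < x) → ∀ (par p : ℕ), p < N →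
    hG N par p c = ∑ m ∈ Finset.Ioc p N, (if par % 2 = 0 then etX N c else etY N c) m
  | [], _, par, p, hp => by
      have : (if par % 2 = 0 then etX N [] else etY N []) = dl N := by
        split_ifs <;> simp [etX, etY]
      rw [this]
      simp only [dl]
      rw [Finset.sum_ite_eq', if_pos (by simp; omega)]
      have hd : (default : Finset (Fin ([] : List ℕ).length)).card = 0 := rfl
      simp [hG, hC, hd]
  | b :: cs, hpos, par, p, hp => by
      obtain ⟨a, rfl⟩ : ∃ a, b = a + 1 :=
        ⟨b - 1, by have := hpos b (by simp); omega⟩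
      have ih := hG_et N cs (fun x hx => hpos x (by simp [hx])) (par + 1)
      have hI : ∀ f : ℕ → ℚ, ∑ m ∈ Finset.Icc (p + 1) N, f m = ∑ m ∈ Finset.Ioc p N, f m := by
        intro f
        apply Finset.sum_congr _ (fun _ _ => rfl)
        ext; simp only [Finset.mem_Icc, Finset.mem_Ioc]; omega
      rw [hG_cons' N par p a hp]
      by_cases hpar : par % 2 = 0
      · have hpar' : ¬ (par + 1) % 2 = 0 := by omega
        simp only [if_neg hpar'] at ih
        rw [if_pos hpar, BS_eq N (wB N par) (wX N) _ (etY N cs) _ ih a (p + 1) (by omega), hI,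
          ih p hp, etX, Nat.add_sub_cancel, q_mm_pow]
        · rw [LinearMap.add_apply, Module.End.mul_apply]
          simp only [Pi.add_apply, Finset.sum_add_distrib]
          rw [add_comm]
          congr 1
          split_ifs <;> simp [Finset.mul_sum]
        · intro n h1 _
          rw [wB, if_pos hpar, wX, if_neg (by omega)]
      · have hpar' : (par + 1) % 2 = 0 := by omega
        simp only [if_pos hpar'] at ih
        rw [if_neg hpar, BS_eq N (wB N par) wY _ (etX N cs) _ ih a (p + 1) (by omega), hI,
          ih p hp, etY, Nat.add_sub_cancel]
        · rw [LinearMap.add_apply, Module.End.mul_apply]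
          simp only [Pi.add_apply, Finset.sum_add_distrib]
          rw [add_comm]
          congr 1
          split_ifs <;> simp [Finset.mul_sum]
        · intro n h1 _
          rw [wB, if_neg hpar, wY]

theorem hN_et (N : ℕ) (hN0 : 0 < N) (c : List ℕ) (hpos : ∀ x ∈ c, 0 < x) :
    hN N c = sgm N (etX N c) := by
  rw [hN_eq_hG, hG_et N c hpos 0 0 hN0, sgm_apply]
  rfl

/-- **Corollary (h in terms of g).**  `h_N(c)` equals the sum over even-odd subsets
`A` of the `1`-positions of `c` and subsets `B` of the `>1`-positions of `c`
containing no (1-based) pair `{2r, 2r+1}`, of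
`(-1)^{#B} · N^{-(#A+#B)} · g_N(c_{(-A)} - δ_B)`. -/
theorem h_eq_sum_g (N s : ℕ) (hNpos : 0 < N) (hs : 0 < s) (c : List ℕ)
    (hlen : c.length = 2 * s) (hpos : ∀ x ∈ c, 0 < x) :
    hN N c =
      ∑ A ∈ (Finset.range c.length).powerset,
        ∑ B ∈ (Finset.range c.length).powerset,
          if (∀ i ∈ A, c.getD i 0 = 1) ∧ EvenOddZ A ∧
              (∀ i ∈ B, 2 ≤ c.getD i 0) ∧
              (∀ i, i % 2 = 1 → ¬(i ∈ B ∧ i + 1 ∈ B)) then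
            (-1 : ℚ) ^ B.card * (1 / (N : ℚ)) ^ (A.card + B.card) *
              gN N (modifyIdx c A B)
          else 0 := by
  obtain ⟨a, d, rfl⟩ : ∃ a d, c = a :: d := by
    cases c with
    | nil => simp at hlen; omega
    | cons a d => exact ⟨a, d, rfl⟩
  have hodd : d.length % 2 = 1 := by
    rw [List.length_cons] at hlen; omega
  have ha : 0 < a := hpos a (by simp)
  have hd : ∀ x ∈ d, 0 < x := fun x hx => hpos x (by simp [hx])
  have key : ∀ a', 0 < a' → SO N d (fun l => gN N (a' :: l)) =
      sgm N ((opA N (wM N) ^ a') (etY N d)) := by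
    intro a' ha'
    have h1 := KK_ga N hNpos d hodd hd ((sgm N) ∘ₗ (opA N (wM N) ^ a'))
    rw [SO_KK N d hodd hd]
    refine Eq.trans ?_ h1
    apply KK_congr N d hodd hd
    intro l hl hl'
    rw [LinearMap.comp_apply, ← ZZ_zero N hNpos a' l hl ha' hl', ← zG_ZZ, ← zdiaL_eq]
    rfl
  rw [rhs_head N a d (gN N) (a :: d) rfl, key a ha, hN_et N hNpos _ hpos, etX,
    sgm_first N hNpos a ha]
  congr 1
  split_ifs with h
  · rw [key (a - 1) (by omega)]
  · rfl
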